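/- For every integer k ≥ 2 and every real δ > 0, there exists a real c > 0 such that for infinitely many n there is a maximal C_{2k+1}-free graph G on n vertices with e(G) ≥ n²/4 − δ·n^{3/2} in which every induced complete bipartite subgraph has at most (1−c)n vertices. -/

import Mathlib

open SimpleGraph

/-- `G` contains a copy of `H` as a (not necessarily induced) subgraph. -/
def HasSubCopy {α β : Type*} (H : SimpleGraph α) (G : SimpleGraph β) : Prop :=
  ∃ f : H →g G, Function.Injective f

/-- `G` is `C_m`-free: it contains no copy of the cycle on `m` vertices. -/
def CycleFree (m : ℕ) {β : Type*} (G : SimpleGraph β) : Prop :=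
  ¬ HasSubCopy (cycleGraph m) G

/-- `G` is a maximal `C_m`-free graph. -/
def MaximalCycleFree (m : ℕ) {β : Type*} (G : SimpleGraph β) : Prop :=
  CycleFree m G ∧
    ∀ v w : β, v ≠ w → ¬ G.Adj v w →
      HasSubCopy (cycleGraph m) (G ⊔ fromEdgeSet {s(v, w)})

/-- The induced subgraph of `G` on `S` is a complete bipartite graph. -/
def IsInducedCompleteBipartiteOn {β : Type*} (G : SimpleGraph β) (S : Set β) : Prop :=
  ∃ A B : Set β, Disjoint A B ∧ A ∪ B = S ∧
    ∀ u ∈ S, ∀ v ∈ S, (G.Adj u v ↔ ((u ∈ A ∧ v ∈ B) ∨ (u ∈ B ∧ v ∈ A)))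

theorem CycleFree.exists_maximal_ge {m : ℕ} {V : Type*} [Finite V] {H : SimpleGraph V}
    (hH : CycleFree m H) : ∃ G, H ≤ G ∧ MaximalCycleFree m G := by
  obtain ⟨G, hHG, hG⟩ :=
    (Set.toFinite {G : SimpleGraph V | CycleFree m G}).exists_le_maximal hH
  refine ⟨G, hHG, hG.prop, fun v w hne hvw => ?_⟩
  by_contra hfree
  have hle := hG.le_of_ge (y := G ⊔ fromEdgeSet {s(v, w)}) hfree le_sup_left
  exact hvw (hle (by simp [hne]))

theorem CycleFree.comap {m : ℕ} {V W : Type*} {G : SimpleGraph V} (hG : CycleFree m G)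
    (e : W ↪ V) : CycleFree m (G.comap e) := by
  rintro ⟨f, hf⟩
  exact hG ⟨(Embedding.comap e G).toHom.comp f, e.injective.comp hf⟩

/-- A map to `ℤ` that changes by `±1` modulo `2k + 3` along edges excludes closed walks of length
`2k + 1`. -/
theorem not_hom_cycleGraph_of_potential {V : Type*} {G : SimpleGraph V} {k : ℕ} (hk : 1 ≤ k)
    (f : cycleGraph (2 * k + 1) →g G) (φ : V → ℤ)
    (hφ : ∀ u ∈ Set.range f, ∀ v ∈ Set.range f, G.Adj u v →
      ∃ ε : ℤ, (ε = 1 ∨ ε = -1) ∧ (2 * k + 3 : ℤ) ∣ φ v - φ u - ε) : False := by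
  have hstep (i : Fin (2 * k + 1)) : (cycleGraph (2 * k + 1)).Adj i (i + 1) := by
    rw [cycleGraph_adj']
    right
    rw [add_sub_cancel_left, Fin.val_one', Nat.mod_eq_of_lt (by omega)]
  choose ε hε hdvd using fun i : Fin (2 * k + 1) =>
    hφ _ ⟨i, rfl⟩ _ ⟨i + 1, rfl⟩ (f.map_adj (hstep i))
  have htel : ∑ i, (φ (f (i + 1)) - φ (f i)) = 0 := by
    rw [Finset.sum_sub_distrib, sub_eq_zero]
    exact Equiv.sum_comp (Equiv.addRight (1 : Fin (2 * k + 1))) fun i => φ (f i)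
  have hsum : (2 * k + 3 : ℤ) ∣ ∑ i, ε i := by
    have := Finset.dvd_sum (s := Finset.univ) fun i _ => hdvd i
    rwa [Finset.sum_sub_distrib, htel, zero_sub, dvd_neg] at this
  have habs : |∑ i, ε i| ≤ 2 * k + 1 := by
    refine (Finset.abs_sum_le_sum_abs _ _).trans ?_
    rw [Finset.sum_congr rfl fun i _ => show |ε i| = 1 by rcases hε i with h | h <;> simp [h]]
    simp
  have hzero : ∑ i, ε i = 0 := Int.eq_zero_of_abs_lt_dvd hsum (by omega)
  have heven : (2 : ℤ) ∣ ∑ i, (ε i - 1) :=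
    Finset.dvd_sum fun i _ => by rcases hε i with h | h <;> norm_num [h]
  rw [Finset.sum_sub_distrib, hzero] at heven
  simp at heven
  omega

/-- The vertices of `gadgetGraph`: two sides `ι × (σ ⊕ ρ)` and, for each `i : ι`, the interior
vertices of a path of length `2k`. -/
abbrev GadgetVertex (k : ℕ) (ι σ ρ : Type*) :=
  (ι × (σ ⊕ ρ)) ⊕ (ι × (σ ⊕ ρ)) ⊕ (ι × Fin (2 * k - 1))

/-- The relation generating `gadgetGraph`. -/
def gadgetRel (k : ℕ) (ι σ ρ : Type*) : GadgetVertex k ι σ ρ → GadgetVertex k ι σ ρ → Prop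
  | .inl a, .inr (.inl b) => ¬ (a.1 = b.1 ∧ a.2.isLeft ∧ b.2.isLeft)
  | .inl a, .inr (.inr x) => a.1 = x.1 ∧ a.2.isLeft ∧ x.2.val = 0
  | .inr (.inl b), .inr (.inr x) => b.1 = x.1 ∧ b.2.isLeft ∧ x.2.val + 1 = 2 * k - 1
  | .inr (.inr x), .inr (.inr y) => x.1 = y.1 ∧ x.2.val + 1 = y.2.val
  | _, _ => False

/-- The complete bipartite graph between two copies of `ι × (σ ⊕ ρ)`, in which for each `i : ι` the
edges between the two copies of `{i} × σ` are replaced by a path of length `2k` whose interior is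
shared by all pairs. -/
def gadgetGraph (k : ℕ) (ι σ ρ : Type*) : SimpleGraph (GadgetVertex k ι σ ρ) :=
  fromRel (gadgetRel k ι σ ρ)

theorem gadgetGraph_adj_of_rel {k : ℕ} {ι σ ρ : Type*} {u v : GadgetVertex k ι σ ρ}
    (h : gadgetRel k ι σ ρ u v) : (gadgetGraph k ι σ ρ).Adj u v := by
  refine (fromRel_adj ..).2 ⟨?_, Or.inl h⟩
  rintro rfl
  rcases u with u | u | u <;> simp [gadgetRel] at h

open Classical in
/-- A potential on `gadgetGraph` along whose edges the value changes by `±1` modulo `2k + 3`, except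
at the vertices `p i` of the paths with `i ≠ i₀`. -/
noncomputable def gadgetPotential {k : ℕ} {ι σ ρ : Type*} (i₀ : ι) (p : ι → ℕ) :
    GadgetVertex k ι σ ρ → ℤ
  | .inl a => if a.1 = i₀ ∧ a.2.isLeft then 0 else 2
  | .inr (.inl b) => if b.1 = i₀ ∧ b.2.isLeft then 3 else 1
  | .inr (.inr x) =>
    if x.1 = i₀ then -(x.2.val + 1)
    else if x.2.val < p x.1 then 1 + ((x.2.val % 2 : ℕ) : ℤ) else 2 - ((x.2.val % 2 : ℕ) : ℤ)

theorem gadgetPotential_step {k : ℕ} (hk : 1 ≤ k) {ι σ ρ : Type*} (i₀ : ι) (p : ι → ℕ)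
    (hp : ∀ i, p i < 2 * k - 1) {u v : GadgetVertex k ι σ ρ} (h : gadgetRel k ι σ ρ u v)
    (hu : ∀ x : ι × Fin (2 * k - 1), u = .inr (.inr x) → x.1 ≠ i₀ → x.2.val ≠ p x.1)
    (hv : ∀ x : ι × Fin (2 * k - 1), v = .inr (.inr x) → x.1 ≠ i₀ → x.2.val ≠ p x.1) :
    ∃ ε : ℤ, (ε = 1 ∨ ε = -1) ∧
      (2 * k + 3 : ℤ) ∣ gadgetPotential i₀ p v - gadgetPotential i₀ p u - ε := by
  have of_sub {x y : ℤ} (h : y - x = 1 ∨ y - x = -1) :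
      ∃ ε : ℤ, (ε = 1 ∨ ε = -1) ∧ (2 * k + 3 : ℤ) ∣ y - x - ε :=
    ⟨y - x, h, by simp⟩
  rcases u with a | b | x <;> rcases v with a' | b' | y <;> simp only [gadgetRel] at h
  · apply of_sub
    simp only [gadgetPotential]
    split_ifs with h1 h2 <;> first | omega | skip
    exact absurd ⟨h2.1.trans h1.1.symm, h2.2, h1.2⟩ h
  · obtain ⟨h1, h2, h3⟩ := h
    have := hv y rfl
    apply of_sub
    simp only [gadgetPotential, h1, h2, h3] at this ⊢
    split_ifs <;> grind
  · obtain ⟨h1, h2, h3⟩ := h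
    have hy := hv y rfl
    have hlt := y.2.isLt
    simp only [gadgetPotential, h1, h2] at hy ⊢
    by_cases hi : y.1 = i₀
    · refine ⟨1, by simp, -1, ?_⟩
      rw [if_pos hi, if_pos ⟨h1.trans hi, h2⟩]
      omega
    · apply of_sub
      rw [if_neg hi, if_neg fun h : b.1 = i₀ ∧ _ => hi (h1 ▸ h.1)]
      have := hy hi
      have := hp y.1
      split_ifs <;> omega
  · obtain ⟨h1, h2⟩ := h
    have hx := hu x rfl
    have hy := hv y rfl
    apply of_sub
    simp only [gadgetPotential, h1] at hx hy ⊢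
    split_ifs <;> grind

theorem gadgetGraph_cycleFree {k : ℕ} (hk : 2 ≤ k) (ι σ ρ : Type*) [Nonempty ι] :
    CycleFree (2 * k + 1) (gadgetGraph k ι σ ρ) := by
  rintro ⟨f, hf⟩
  obtain ⟨i₀, hi₀⟩ : ∃ i₀ : ι, ∀ i ≠ i₀, ∃ j : Fin (2 * k - 1),
      (.inr (.inr (i, j)) : GadgetVertex k ι σ ρ) ∉ Set.range f := by
    by_contra! hcon
    obtain ⟨i, -, hi⟩ := hcon (Classical.arbitrary ι)
    obtain ⟨i', hne, hi'⟩ := hcon i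
    choose g hg using hi
    choose g' hg' using hi'
    have hinj : Function.Injective (Sum.elim g g') := by
      rintro (a | a) (b | b) hab <;> have hab' := congrArg f hab <;>
        simp only [Sum.elim_inl, Sum.elim_inr, hg, hg'] at hab' <;> grind
    have := Fintype.card_le_of_injective _ hinj
    simp at this
    omega
  have : Nonempty (Fin (2 * k - 1)) := ⟨⟨0, by omega⟩⟩
  choose! p hp using hi₀
  let q (i : ι) : ℕ := (p i).val
  refine not_hom_cycleGraph_of_potential (by omega) f (gadgetPotential i₀ q) fun u hu v hv huv => ?_
  have hmiss {w : GadgetVertex k ι σ ρ} (hw : w ∈ Set.range f) (x : ι × Fin (2 * k - 1))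
      (hx : w = .inr (.inr x)) (hi : x.1 ≠ i₀) : x.2.val ≠ q x.1 := by
    intro heq
    apply hp x.1 hi
    rwa [← Fin.ext heq, ← hx]
  rcases ((fromRel_adj ..).1 huv).2 with h | h
  · exact gadgetPotential_step (by omega) i₀ q (fun i => (p i).isLt) h (hmiss hu) (hmiss hv)
  · obtain ⟨ε, hε, m, hm⟩ :=
      gadgetPotential_step (by omega) i₀ q (fun i => (p i).isLt) h (hmiss hv) (hmiss hu)
    exact ⟨-ε, by omega, -m, by linarith⟩

theorem not_adj_of_cycleFree_supergraph {k : ℕ} (hk : 1 ≤ k) {ι σ ρ W : Type*} {G : SimpleGraph W}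
    (hG : CycleFree (2 * k + 1) G) (g : gadgetGraph k ι σ ρ →g G) (hg : Function.Injective g)
    (i : ι) (s s' : σ) : ¬ G.Adj (g (.inl (i, .inl s))) (g (.inr (.inl (i, .inl s')))) := by
  intro hadj
  let c : Fin (2 * k + 1) → GadgetVertex k ι σ ρ := fun j =>
    if h0 : j.val = 0 then .inl (i, .inl s)
    else if h1 : j.val = 2 * k then .inr (.inl (i, .inl s'))
    else .inr (.inr (i, ⟨j.val - 1, by omega⟩))
  have hc : Function.Injective c := by
    intro a b hab
    simp only [c] at hab
    ext
    split_ifs at hab <;> simp at hab <;> omega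
  have c_first {j : Fin (2 * k + 1)} (h : j.val = 0) : c j = .inl (i, .inl s) := dif_pos h
  have c_last {j : Fin (2 * k + 1)} (h : j.val = 2 * k) : c j = .inr (.inl (i, .inl s')) := by
    simp only [c]
    rw [dif_neg (by omega), dif_pos h]
  have c_mid {j : Fin (2 * k + 1)} (h0 : j.val ≠ 0) (h1 : j.val ≠ 2 * k) :
      c j = .inr (.inr (i, ⟨j.val - 1, by omega⟩)) := by
    simp only [c]
    rw [dif_neg h0, dif_neg h1]
  have hstep {a b : Fin (2 * k + 1)} (hab : (b - a).val = 1) : G.Adj (g (c a)) (g (c b)) := by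
    have ha := a.isLt
    have hb := b.isLt
    rcases le_or_gt a b with hle | hlt
    · rw [Fin.sub_val_of_le hle] at hab
      apply g.map_adj
      by_cases h0 : a.val = 0
      · rw [c_first h0, c_mid (by omega) (by omega)]
        exact gadgetGraph_adj_of_rel ⟨rfl, rfl, by simp; omega⟩
      rw [c_mid h0 (by omega)]
      by_cases h1 : b.val = 2 * k
      · rw [c_last h1]
        apply Adj.symm
        exact gadgetGraph_adj_of_rel ⟨rfl, rfl, by simp; omega⟩
      · rw [c_mid (by omega) h1]
        exact gadgetGraph_adj_of_rel ⟨rfl, by simp; omega⟩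
    · rw [Fin.coe_sub_iff_lt.2 hlt] at hab
      rw [c_last (show a.val = 2 * k by omega), c_first (show b.val = 0 by omega)]
      exact hadj.symm
  refine hG ⟨⟨fun j => g (c j), fun {a b} hab => ?_⟩, hg.comp hc⟩
  rcases cycleGraph_adj'.1 hab with h | h
  · exact (hstep h).symm
  · exact hstep h

theorem card_sq_le_ncard_edgeSet_supergraph {k : ℕ} {ι σ ρ W : Type*} [Fintype ι] [Fintype σ]
    [Fintype ρ] [Finite W] {G : SimpleGraph W} (g : gadgetGraph k ι σ ρ →g G)
    (hg : Function.Injective g) :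
    (Fintype.card ι * (Fintype.card σ + Fintype.card ρ)) ^ 2 ≤
      G.edgeSet.ncard + Fintype.card ι * Fintype.card σ ^ 2 := by
  classical
  let blocked : Finset ((ι × (σ ⊕ ρ)) × (ι × (σ ⊕ ρ))) :=
    Finset.univ.image fun x : ι × σ × σ => ((x.1, .inl x.2.1), (x.1, .inl x.2.2))
  have hblocked : blocked.card ≤ Fintype.card ι * Fintype.card σ ^ 2 :=
    Finset.card_image_le.trans (by simp [sq])
  have hgood : ((blockedᶜ : Finset _) : Set ((ι × (σ ⊕ ρ)) × (ι × (σ ⊕ ρ)))).ncard ≤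
      G.edgeSet.ncard := by
    refine Set.ncard_le_ncard_of_injOn (fun x => s(g (.inl x.1), g (.inr (.inl x.2)))) ?_ ?_
      (Set.toFinite _)
    · rintro ⟨⟨i, s⟩, ⟨i', s'⟩⟩ hx
      refine (mem_edgeSet G).2 (g.map_adj (gadgetGraph_adj_of_rel ?_))
      rintro ⟨h, hs, hs'⟩
      dsimp only at h hs hs'
      subst h
      obtain ⟨s, rfl⟩ := Sum.isLeft_iff.1 hs
      obtain ⟨s', rfl⟩ := Sum.isLeft_iff.1 hs'
      simp [blocked] at hx
    · rintro ⟨a, b⟩ - ⟨a', b'⟩ - hab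
      simpa [hg.eq_iff] using hab
  rw [Set.ncard_coe_finset] at hgood
  have := Finset.card_add_card_compl blocked
  simp only [Fintype.card_prod, Fintype.card_sum] at this
  rw [sq]
  omega

theorem card_le_ncard_compl_of_isInducedCompleteBipartiteOn_supergraph {k : ℕ} (hk : 1 ≤ k)
    {ι σ ρ W : Type*} [Fintype ι] [Fintype σ] [Finite W] {G : SimpleGraph W}
    (hG : CycleFree (2 * k + 1) G) (g : gadgetGraph k ι σ ρ →g G) (hg : Function.Injective g)
    {S : Set W} (hS : IsInducedCompleteBipartiteOn G S) :
    Fintype.card ι * Fintype.card σ ≤ Sᶜ.ncard + 2 * Fintype.card σ := by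
  classical
  obtain ⟨A, B, hAB, rfl, hadj⟩ := hS
  have hside {u v : W} (hu : u ∈ A ∪ B) (hv : v ∈ A ∪ B) : G.Adj u v ↔ ¬ (u ∈ A ↔ v ∈ A) := by
    have hnot {w : W} (h : w ∈ A) : w ∉ B := Set.disjoint_left.1 hAB h
    have := @hnot u
    have := @hnot v
    have := hadj u hu v hv
    simp only [Set.mem_union] at hu hv
    tauto
  let a (i : ι) (s : σ) : W := g (.inl (i, .inl s))
  let b (i : ι) (s : σ) : W := g (.inr (.inl (i, .inl s)))
  let full : Finset ι := {i | (∃ s, a i s ∈ A ∪ B) ∧ ∃ s, b i s ∈ A ∪ B}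
  have hfull : full.card ≤ 2 := by
    have hmem (i : full) : (∃ s, a i s ∈ A ∪ B) ∧ ∃ s, b i s ∈ A ∪ B := by
      simpa [full] using i.2
    choose sa hsa using fun i => (hmem i).1
    choose sb hsb using fun i => (hmem i).2
    have hinj : Function.Injective fun i : full => decide (a i (sa i) ∈ A) := by
      intro i j hij
      by_contra hne
      have hij : a i (sa i) ∈ A ↔ a j (sa j) ∈ A := by simpa using hij
      have h1 := (hside (hsa j) (hsb j)).not.1 (not_adj_of_cycleFree_supergraph hk hG g hg j _ _)
      have h2 := (hside (hsa i) (hsb j)).1 (g.map_adj (gadgetGraph_adj_of_rel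
        fun h => hne (Subtype.ext h.1)))
      tauto
    simpa using Fintype.card_le_of_injective _ hinj
  have hcompl : ((fullᶜ ×ˢ Finset.univ : Finset (ι × σ)) : Set (ι × σ)).ncard ≤
      (A ∪ B)ᶜ.ncard := by
    refine Set.ncard_le_ncard_of_injOn
      (fun x => if ∃ s, a x.1 s ∈ A ∪ B then b x.1 x.2 else a x.1 x.2) ?_ ?_ (Set.toFinite _)
    · rintro ⟨i, s⟩ hi
      simp only [Finset.coe_product, Set.mem_prod, Finset.mem_coe, Finset.mem_compl,
        Finset.mem_filter, full, Finset.mem_univ, true_and, not_and, not_exists, and_true] at hi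
      dsimp only
      split_ifs with h
      · exact hi h s
      · exact fun hs => h ⟨s, hs⟩
    · rintro ⟨i, s⟩ - ⟨j, s'⟩ - h
      dsimp only [a, b] at h
      split_ifs at h <;> have := hg h <;> grind
  rw [Set.ncard_coe_finset, Finset.card_product, Finset.card_univ, Finset.card_compl] at hcompl
  have := Nat.mul_le_mul_right (Fintype.card σ)
    (show Fintype.card ι ≤ (Fintype.card ι - full.card) + 2 by omega)
  rw [add_mul] at this
  omega

theorem stmt_16 (k : ℕ) (hk : 2 ≤ k) (δ : ℝ) (hδ : 0 < δ) :
    ∃ c : ℝ, 0 < c ∧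
      ∀ N : ℕ, ∃ n : ℕ, N ≤ n ∧
        ∃ G : SimpleGraph (Fin n),
          MaximalCycleFree (2 * k + 1) G ∧
          (n : ℝ) ^ 2 / 4 - δ * (n : ℝ) ^ ((3 : ℝ) / 2) ≤ (G.edgeSet.ncard : ℝ) ∧
          ∀ S : Set (Fin n), IsInducedCompleteBipartiteOn G S →
            (S.ncard : ℝ) ≤ (1 - c) * n := by
  obtain ⟨r, hr⟩ := exists_nat_ge (((k : ℝ) + 1) ^ 2 / δ)
  rw [div_le_iff₀ hδ] at hr
  have hr1 : 1 ≤ r := by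
    by_contra! h
    obtain rfl : r = 0 := by omega
    simp at hr
    nlinarith
  refine ⟨1 / (4 * r ^ 2 + 4 * k), by positivity, fun N => ?_⟩
  set t := max N 4
  have ht4 : 4 ≤ t := le_max_right ..
  obtain ⟨d, hd⟩ := Nat.exists_eq_add_of_le (Nat.le_mul_of_pos_left t (pow_pos hr1 2))
  have : NeZero t := ⟨by omega⟩
  set n := Fintype.card (GadgetVertex k (Fin t) (Fin t) (Fin d))
  have hn : n = 2 * (t * (r ^ 2 * t)) + t * (2 * k - 1) := by
    simp [n, hd]
    ring
  have hnN : N ≤ n := by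
    have : N ≤ t := le_max_left ..
    have : t * 1 ≤ t * (2 * k - 1) := Nat.mul_le_mul_left t (by omega)
    omega
  let e : Fin n ≃ GadgetVertex k (Fin t) (Fin t) (Fin d) := (Fintype.equivFin _).symm
  obtain ⟨G, hle, hG⟩ := ((gadgetGraph_cycleFree hk (Fin t) (Fin t) (Fin d)).comap
    e.toEmbedding).exists_maximal_ge
  let g : gadgetGraph k (Fin t) (Fin t) (Fin d) →g G :=
    ⟨e.symm, fun {u v} huv => hle (by simpa using huv)⟩
  have hg : Function.Injective g := e.symm.injective
  have hnR : (n : ℝ) = 2 * (r ^ 2 * t ^ 2) + t * (2 * k - 1) := by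
    rw [hn]
    push_cast [Nat.cast_sub (show 1 ≤ 2 * k by omega)]
    ring
  have hkR : (2 : ℝ) ≤ k := by exact_mod_cast hk
  have htR : (4 : ℝ) ≤ t := by exact_mod_cast ht4
  have hrR : (1 : ℝ) ≤ r := by exact_mod_cast hr1
  refine ⟨n, hnN, G, hG, ?_, fun S hS => ?_⟩
  · have hedges := card_sq_le_ncard_edgeSet_supergraph g hg
    simp only [Fintype.card_fin, ← hd] at hedges
    have hedges : ((t : ℝ) * (r ^ 2 * t)) ^ 2 ≤ G.edgeSet.ncard + t * t ^ 2 := by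
      exact_mod_cast hedges
    have hpow : ((r : ℝ) * t) ^ 3 ≤ (n : ℝ) ^ ((3 : ℝ) / 2) := by
      have hsq : ((r : ℝ) * t) ^ 2 ≤ n := by
        rw [hnR]
        nlinarith [mul_pos (show (0 : ℝ) < t by linarith) (show (0 : ℝ) < 2 * k - 1 by linarith),
          sq_nonneg ((r : ℝ) * t)]
      calc ((r : ℝ) * t) ^ 3 = (((r : ℝ) * t) ^ 2) ^ ((3 : ℝ) / 2) := by
            rw [← Real.rpow_natCast, ← Real.rpow_natCast, ← Real.rpow_mul (by positivity)]
            norm_num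
        _ ≤ _ := Real.rpow_le_rpow (by positivity) hsq (by norm_num)
    have hcost : (2 * k - 1) * r ^ 2 * (t : ℝ) ^ 3 + (2 * k - 1) ^ 2 * t ^ 2 / 4 + t ^ 3 ≤
        δ * ((r : ℝ) * t) ^ 3 := by
      have hr2 : (1 : ℝ) ≤ r ^ 2 := one_le_pow₀ hrR
      have ht3 : (0 : ℝ) ≤ t ^ 3 := by positivity
      have ht23 : (t : ℝ) ^ 2 ≤ r ^ 2 * t ^ 3 := by
        have : (t : ℝ) ^ 2 ≤ t ^ 3 := pow_le_pow_right₀ (by linarith) (by norm_num)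
        nlinarith
      calc (2 * k - 1) * (r : ℝ) ^ 2 * (t : ℝ) ^ 3 + (2 * k - 1) ^ 2 * t ^ 2 / 4 + t ^ 3
          ≤ ((2 * k - 1) + (2 * k - 1) ^ 2 / 4 + 1) * ((r : ℝ) ^ 2 * t ^ 3) := by
            have h1 := mul_le_mul_of_nonneg_left ht23
              (show 0 ≤ (2 * (k : ℝ) - 1) ^ 2 / 4 by positivity)
            have h2 := le_mul_of_one_le_left ht3 hr2
            linarith
        _ ≤ ((k : ℝ) + 1) ^ 2 * (r ^ 2 * t ^ 3) := by
            gcongr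
            linarith
        _ ≤ r * δ * (r ^ 2 * t ^ 3) := by gcongr
        _ = _ := by ring
    have := mul_le_mul_of_nonneg_left hpow hδ.le
    rw [show (n : ℝ) ^ 2 / 4 = ((t : ℝ) * (r ^ 2 * t)) ^ 2 + (2 * k - 1) * r ^ 2 * (t : ℝ) ^ 3 +
      (2 * k - 1) ^ 2 * t ^ 2 / 4 by rw [hnR]; ring]
    linarith
  · have hloss := card_le_ncard_compl_of_isInducedCompleteBipartiteOn_supergraph (by omega) hG.1
      g hg hS
    have htotal := Set.ncard_add_ncard_compl S
    simp only [Nat.card_eq_fintype_card, Fintype.card_fin] at hloss htotal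
    have hloss : (t : ℝ) * t ≤ Sᶜ.ncard + 2 * t := by exact_mod_cast hloss
    have htotal : (S.ncard : ℝ) + Sᶜ.ncard = n := by exact_mod_cast htotal
    have hc : 1 / (4 * (r : ℝ) ^ 2 + 4 * k) * n ≤ t ^ 2 / 2 := by
      rw [one_div, inv_mul_le_iff₀ (by positivity), hnR]
      have h1 : 2 * (k : ℝ) - 1 ≤ 2 * k * t := by nlinarith
      have h2 := mul_le_mul_of_nonneg_left h1 (show (0 : ℝ) ≤ t by positivity)
      linarith
    nlinarith
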